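/- (Proposition 1, converse part.) Fix θ ∈ Θ and points x_1,…,x_n ∈ ℝ^m, and let 𝓜_θ^{(n)} be the set of signed finite measures Q supported on {x_1,…,x_n} with Σ_{i=1}^n Q({x_i}) = 1 and Σ_{i=1}^n Q({x_i}) g(x_i,θ) = 0. Suppose there exists a maximizer t̂ ∈ ℝ^{1+l} of t ↦ t_0 − (1/n) Σ_{i=1}^n ψ(tᵀḡ(x_i,θ)) satisfying a* < t̂ᵀḡ(x_i,θ) < b* for all i = 1,…,n. Then inf_{Q∈𝓜_θ^{(n)}} (1/n) Σ_{i=1}^n φ(n Q({x_i})) = sup_{t∈ℝ^{1+l}} { t_0 − (1/n) Σ_{i=1}^n ψ(tᵀḡ(x_i,θ)) }, the primal infimum is attained at a unique Q^{(n)}_θ ∈ 𝓜_θ^{(n)}, given by Q^{(n)}_θ({x_i}) = (1/n)(φ')⁻¹(t̂ᵀḡ(x_i,θ)) for i = 1,…,n, and t̂ satisfies (1/n) Σ_{i=1}^n (φ')⁻¹(t̂ᵀḡ(x_i,θ)) = 1 and (1/n) Σ_{i=1}^n g_j(x_i,θ)(φ')⁻¹(t̂ᵀḡ(x_i,θ))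 = 0 for j = 1,…,l. -/

import Mathlib

open MeasureTheory ProbabilityTheory Filter Set Topology
open scoped ENNReal NNReal

noncomputable section

/-- Fenchel-Legendre convex conjugate `ψ(t) = sup_{x ∈ ℝ} {t·x − φ(x)}` of an
`[0,∞]`-valued function `φ` on `ℝ`. -/
def psi (φ : ℝ → ℝ≥0∞) (t : ℝ) : EReal :=
  ⨆ x : ℝ, ((t * x : ℝ) : EReal) - ((φ x : ℝ≥0∞) : EReal)

/-- `tᵀ ḡ(x,θ) = t₀ + ∑ⱼ tⱼ gⱼ(x,θ)`, where `ḡ := (𝟙, g₁, …, g_l)ᵀ`. -/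
def tbar {l : ℕ} (t : Fin (l + 1) → ℝ) (gx : Fin l → ℝ) : ℝ :=
  t 0 + ∑ j : Fin l, t j.succ * gx j

/-- Standing assumptions on the divergence function `φ : ℝ → [0,∞]`: `φ(1) = 0`, `φ` is
convex and closed (lower semicontinuous), its effective domain is an interval with
endpoints `a < 1 < b`, `φ` is strictly convex and twice continuously differentiable
(with derivatives `φ'`, `φ''`) on `]a,b[`, and essentially smooth; `a* = lim_{x→−∞} φ(x)/x`
and `b* = lim_{x→+∞} φ(x)/x` are the endpoints of the domain of the conjugate `ψ`. -/
structure PhiAssumptions (φ : ℝ → ℝ≥0∞) (a b : EReal) (φ' φ'' : ℝ → ℝ)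
    (astar bstar : EReal) : Prop where
  one : φ 1 = 0
  a_lt_one : a < ((1 : ℝ) : EReal)
  one_lt_b : ((1 : ℝ) : EReal) < b
  dom_finite : ∀ x : ℝ, a < (x : EReal) → (x : EReal) < b → φ x ≠ ⊤
  dom_infinite : ∀ x : ℝ, ((x : EReal) < a ∨ b < (x : EReal)) → φ x = ⊤
  closed : LowerSemicontinuous fun x : ℝ => ((φ x : ℝ≥0∞) : EReal)
  convex : ∀ x y p q : ℝ, 0 ≤ p → 0 ≤ q → p + q = 1 →
    φ (p * x + q * y) ≤ ENNReal.ofReal p * φ x + ENNReal.ofReal q * φ y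
  strictConvexOn : StrictConvexOn ℝ {x : ℝ | a < (x : EReal) ∧ (x : EReal) < b}
    fun x => (φ x).toReal
  deriv1 : ∀ x : ℝ, a < (x : EReal) → (x : EReal) < b →
    HasDerivAt (fun y => (φ y).toReal) (φ' x) x
  deriv2 : ∀ x : ℝ, a < (x : EReal) → (x : EReal) < b → HasDerivAt φ' (φ'' x) x
  deriv2_pos : ∀ x : ℝ, a < (x : EReal) → (x : EReal) < b → 0 < φ'' x
  deriv2_cont : ContinuousOn φ'' {x : ℝ | a < (x : EReal) ∧ (x : EReal) < b}
  ess_smooth_a : ∀ r : ℝ, a = (r : EReal) → Tendsto φ' (𝓝[>] r) atBot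
  ess_smooth_b : ∀ r : ℝ, b = (r : EReal) → Tendsto φ' (𝓝[<] r) atTop
  astar_lim :
    Tendsto (fun x : ℝ => ((φ x : ℝ≥0∞) : EReal) * ((x⁻¹ : ℝ) : EReal)) atBot (𝓝 astar)
  bstar_lim :
    Tendsto (fun x : ℝ => ((φ x : ℝ≥0∞) : EReal) * ((x⁻¹ : ℝ) : EReal)) atTop (𝓝 bstar)

/-- The empirical measure `P_n = (1/n) ∑ᵢ δ_{xᵢ}`. -/
def PnEmp {mdim : ℕ} (n : ℕ) (x : Fin n → Fin mdim → ℝ) : Measure (Fin mdim → ℝ) :=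
  (n : ℝ≥0∞)⁻¹ • ∑ i : Fin n, Measure.dirac (x i)

/-- `𝓜_θ⁽ⁿ⁾`: signed finite measures `Q` supported on `{x₁,…,x_n}` (i.e. absolutely
continuous w.r.t. `P_n`) with `∑ᵢ Q({xᵢ}) = 1` and `∑ᵢ Q({xᵢ}) g(xᵢ,θ) = 0`. -/
def MThetaN {mdim d l : ℕ} (n : ℕ) (x : Fin n → Fin mdim → ℝ)
    (g : (Fin mdim → ℝ) → (Fin d → ℝ) → Fin l → ℝ) (θ : Fin d → ℝ) :
    Set (SignedMeasure (Fin mdim → ℝ)) :=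
  {Q | Q ≪ᵥ (PnEmp n x).toENNRealVectorMeasure ∧ (∑ i : Fin n, Q {x i}) = 1 ∧
    ∀ j : Fin l, (∑ i : Fin n, Q {x i} * g (x i) θ j) = 0}

/-- The primal criterion `Q ↦ (1/n) ∑ᵢ φ(n Q({xᵢ})) = ∫ φ(dQ/dP_n) dP_n`. -/
def primalObjN (φ : ℝ → ℝ≥0∞) {mdim : ℕ} (n : ℕ) (x : Fin n → Fin mdim → ℝ)
    (Q : SignedMeasure (Fin mdim → ℝ)) : ℝ≥0∞ :=
  (n : ℝ≥0∞)⁻¹ * ∑ i : Fin n, φ ((n : ℝ) * Q {x i})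

/-- The dual criterion `t ↦ t₀ − (1/n) ∑ᵢ ψ(tᵀḡ(xᵢ,θ))`, with values in `[−∞,+∞]`. -/
def dualValN (φ : ℝ → ℝ≥0∞) {mdim d l : ℕ} (n : ℕ) (x : Fin n → Fin mdim → ℝ)
    (g : (Fin mdim → ℝ) → (Fin d → ℝ) → Fin l → ℝ) (θ : Fin d → ℝ)
    (t : Fin (l + 1) → ℝ) : EReal :=
  ((t 0 : ℝ) : EReal) -
    (((n : ℝ)⁻¹ : ℝ) : EReal) * ∑ i : Fin n, psi φ (tbar t (g (x i) θ))

namespace PhiAssumptions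

variable {φ : ℝ → ℝ≥0∞} {a b : EReal} {φ' φ'' : ℝ → ℝ} {astar bstar : EReal}

/-- The real-valued version of `φ` is convex on the effective domain of `φ`. -/
lemma convexOn_toReal (hφ : PhiAssumptions φ a b φ' φ'' astar bstar) :
    ConvexOn ℝ {y | φ y ≠ ⊤} fun y => (φ y).toReal := by
  have hne : ∀ ⦃x y p q : ℝ⦄, φ x ≠ ⊤ → φ y ≠ ⊤ →
      ENNReal.ofReal p * φ x + ENNReal.ofReal q * φ y ≠ ⊤ := fun x y p q hx hy =>
    ENNReal.add_ne_top.2 ⟨ENNReal.mul_ne_top ENNReal.ofReal_ne_top hx,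
      ENNReal.mul_ne_top ENNReal.ofReal_ne_top hy⟩
  refine ⟨fun x hx y hy p q hp hq hpq => ?_, fun x hx y hy p q hp hq hpq => ?_⟩
  · exact ne_top_of_le_ne_top (hne hx hy) (hφ.convex x y p q hp hq hpq)
  · have h := ENNReal.toReal_mono (hne hx hy) (hφ.convex x y p q hp hq hpq)
    rw [ENNReal.toReal_add (ENNReal.mul_ne_top ENNReal.ofReal_ne_top hx)
      (ENNReal.mul_ne_top ENNReal.ofReal_ne_top hy), ENNReal.toReal_mul, ENNReal.toReal_mul,
      ENNReal.toReal_ofReal hp, ENNReal.toReal_ofReal hq] at h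
    simpa only [smul_eq_mul] using h

/-- The graph of `φ` lies above its tangent at any point of `]a,b[`. -/
lemma tangent_le (hφ : PhiAssumptions φ a b φ' φ'' astar bstar) {q y : ℝ}
    (hq : a < (q : EReal) ∧ (q : EReal) < b) (hy : φ y ≠ ⊤) :
    (φ q).toReal + φ' q * (y - q) ≤ (φ y).toReal := by
  have hd := hφ.deriv1 q hq.1 hq.2
  have hqt := hφ.dom_finite q hq.1 hq.2
  rcases lt_trichotomy q y with h | rfl | h
  · have := hφ.convexOn_toReal.le_slope_of_hasDerivAt hqt hy h hd
    rw [slope_def_field, le_div_iff₀ (sub_pos.2 h)] at this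
    linarith
  · simp
  · have := hφ.convexOn_toReal.slope_le_of_hasDerivAt hy hqt h hd
    rw [slope_def_field, div_le_iff₀ (sub_pos.2 h)] at this
    linarith

/-- The graph of `φ` meets its tangent at a point of `]a,b[` only at that point. -/
lemma eq_of_le_tangent (hφ : PhiAssumptions φ a b φ' φ'' astar bstar) {q y : ℝ}
    (hq : a < (q : EReal) ∧ (q : EReal) < b) (hy : φ y ≠ ⊤)
    (h : (φ y).toReal ≤ (φ q).toReal + φ' q * (y - q)) : y = q := by
  by_contra hne
  have hay : a ≤ (y : EReal) := not_lt.1 fun h' => hy (hφ.dom_infinite y (Or.inl h'))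
  have hyb : (y : EReal) ≤ b := not_lt.1 fun h' => hy (hφ.dom_infinite y (Or.inr h'))
  have hqt := hφ.dom_finite q hq.1 hq.2
  set z : ℝ := (1 / 2 : ℝ) * q + (1 / 2 : ℝ) * y with hz
  have hzI : a < (z : EReal) ∧ (z : EReal) < b := by
    rcases lt_or_gt_of_ne hne with h' | h'
    · exact ⟨hay.trans_lt (EReal.coe_lt_coe_iff.2 (by linarith)),
        lt_trans (EReal.coe_lt_coe_iff.2 (by linarith)) hq.2⟩
    · exact ⟨hq.1.trans (EReal.coe_lt_coe_iff.2 (by linarith)),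
        lt_of_lt_of_le (EReal.coe_lt_coe_iff.2 (by linarith)) hyb⟩
  have hqz : q ≠ z := fun h' => hne (by linarith)
  have hz_le := hφ.convexOn_toReal.2 hqt hy (by norm_num : (0 : ℝ) ≤ 1 / 2)
    (by norm_num : (0 : ℝ) ≤ 1 / 2) (by norm_num)
  have hw_lt := hφ.strictConvexOn.2 hq hzI hqz (by norm_num : (0 : ℝ) < 1 / 2)
    (by norm_num : (0 : ℝ) < 1 / 2) (by norm_num)
  have hwI := hφ.strictConvexOn.1 hq hzI (by norm_num : (0 : ℝ) ≤ 1 / 2)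
    (by norm_num : (0 : ℝ) ≤ 1 / 2) (by norm_num)
  have hw_ge := hφ.tangent_le hq (hφ.dom_finite _ hwI.1 hwI.2)
  simp only [smul_eq_mul] at hz_le hw_lt hw_ge
  rw [← hz] at hz_le
  have e1 : φ' q * (1 / 2 * q + 1 / 2 * z - q) = φ' q * (y - q) / 4 := by rw [hz]; ring
  rw [e1] at hw_ge
  linarith

/-- At a slope `φ' q` with `q ∈ ]a,b[`, the supremum defining the conjugate is attained at `q`. -/
lemma psi_eq (hφ : PhiAssumptions φ a b φ' φ'' astar bstar) {q s : ℝ}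
    (hq : a < (q : EReal) ∧ (q : EReal) < b) (hs : φ' q = s) :
    psi φ s = ((s * q - (φ q).toReal : ℝ) : EReal) := by
  have coe : ∀ {y : ℝ}, φ y ≠ ⊤ → ((φ y : ℝ≥0∞) : EReal) = ((φ y).toReal : ℝ) := fun h =>
    (EReal.coe_ennreal_toReal h).symm
  refine le_antisymm (iSup_le fun y => ?_) ?_
  · by_cases hy : φ y = ⊤
    · simp [hy]
    · rw [coe hy, ← EReal.coe_sub, EReal.coe_le_coe_iff]
      have := hφ.tangent_le hq hy
      rw [hs] at this
      linarith
  · refine le_trans (le_of_eq ?_) (le_iSup _ q)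
    rw [coe (hφ.dom_finite q hq.1 hq.2), ← EReal.coe_sub]

/-- A left inverse of `φ'` on `]a,b[` is continuous at `φ' q`, and it is a right inverse with
values in `]a,b[` near `φ' q`. -/
lemma tendsto_inverse (hφ : PhiAssumptions φ a b φ' φ'' astar bstar) {invφ' : ℝ → ℝ}
    (hinv : ∀ y : ℝ, a < (y : EReal) → (y : EReal) < b → invφ' (φ' y) = y) {q : ℝ}
    (hq : a < (q : EReal) ∧ (q : EReal) < b) :
    Tendsto invφ' (𝓝 (φ' q)) (𝓝 q) ∧ ∀ᶠ s in 𝓝 (φ' q),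
      (a < ((invφ' s : ℝ) : EReal) ∧ ((invφ' s : ℝ) : EReal) < b) ∧ φ' (invφ' s) = s := by
  have hopen : IsOpen {y : ℝ | a < (y : EReal) ∧ (y : EReal) < b} :=
    (isOpen_lt continuous_const continuous_coe_real_ereal).inter
      (isOpen_lt continuous_coe_real_ereal continuous_const)
  have hnhds := hopen.mem_nhds hq
  have hstrict : HasStrictDerivAt φ' (φ'' q) q :=
    hasStrictDerivAt_of_hasDerivAt_of_continuousAt
      (mem_of_superset hnhds fun y hy => hφ.deriv2 y hy.1 hy.2) (hφ.deriv2_cont.continuousAt hnhds)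
  rw [← hstrict.map_nhds_eq (hφ.deriv2_pos q hq.1 hq.2).ne', tendsto_map'_iff, eventually_map]
  refine ⟨tendsto_id.congr' (mem_of_superset hnhds fun y hy => (hinv y hy.1 hy.2).symm),
    mem_of_superset hnhds fun y hy => ?_⟩
  have hy' : invφ' (φ' y) = y := hinv y hy.1 hy.2
  simp only [mem_ofPred_eq, hy', and_true]
  exact hy

/-- The dual criterion at a parameter whose arguments of `ψ` are slopes of `φ`. -/
lemma dualValN_eq (hφ : PhiAssumptions φ a b φ' φ'' astar bstar) {mdim d l n : ℕ}
    (x : Fin n → Fin mdim → ℝ) (g : (Fin mdim → ℝ) → (Fin d → ℝ) → Fin l → ℝ) (θ : Fin d → ℝ)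
    {t : Fin (l + 1) → ℝ} {q : Fin n → ℝ}
    (hq : ∀ i, (a < (q i : EReal) ∧ (q i : EReal) < b) ∧ φ' (q i) = tbar t (g (x i) θ)) :
    dualValN φ n x g θ t =
      ((t 0 - (n : ℝ)⁻¹ * ∑ i, (tbar t (g (x i) θ) * q i - (φ (q i)).toReal) : ℝ) : EReal) := by
  have hsum : ∑ i, psi φ (tbar t (g (x i) θ)) =
      ((∑ i, (tbar t (g (x i) θ) * q i - (φ (q i)).toReal) : ℝ) : EReal) := by
    simp only [fun i => hφ.psi_eq (hq i).1 (hq i).2]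
    exact (map_sum (⟨⟨Real.toEReal, EReal.coe_zero⟩, EReal.coe_add⟩ : ℝ →+ EReal) _ _).symm
  rw [dualValN, hsum, ← EReal.coe_mul, ← EReal.coe_sub]

end PhiAssumptions

lemma tbar_add_smul {l : ℕ} (t v : Fin (l + 1) → ℝ) (h : ℝ) (gx : Fin l → ℝ) :
    tbar (t + h • v) gx = tbar t gx + h * tbar v gx := by
  simp only [tbar, Pi.add_apply, Pi.smul_apply, smul_eq_mul, mul_add, Finset.mul_sum, add_mul,
    Finset.sum_add_distrib, mul_assoc]
  ring

/-- First-order optimality, in direction `v`, of a maximizer of the dual criterion. -/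
lemma PhiAssumptions.first_order_le {φ : ℝ → ℝ≥0∞} {a b : EReal} {φ' φ'' : ℝ → ℝ}
    {astar bstar : EReal} (hφ : PhiAssumptions φ a b φ' φ'' astar bstar) {invφ' : ℝ → ℝ}
    (hinv : ∀ y : ℝ, a < (y : EReal) → (y : EReal) < b → invφ' (φ' y) = y) {mdim d l n : ℕ}
    {x : Fin n → Fin mdim → ℝ} {g : (Fin mdim → ℝ) → (Fin d → ℝ) → Fin l → ℝ} {θ : Fin d → ℝ}
    {t : Fin (l + 1) → ℝ}
    (hmax : ∀ t' : Fin (l + 1) → ℝ, dualValN φ n x g θ t' ≤ dualValN φ n x g θ t)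
    {q : Fin n → ℝ}
    (hq : ∀ i, (a < (q i : EReal) ∧ (q i : EReal) < b) ∧ φ' (q i) = tbar t (g (x i) θ))
    (v : Fin (l + 1) → ℝ) :
    v 0 ≤ (n : ℝ)⁻¹ * ∑ i, tbar v (g (x i) θ) * q i := by
  set s : Fin n → ℝ := fun i => tbar t (g (x i) θ) with hs
  set δ : Fin n → ℝ := fun i => tbar v (g (x i) θ) with hδ
  have hpath : ∀ i, Tendsto (fun h : ℝ => s i + h * δ i) (𝓝[>] 0) (𝓝 (φ' (q i))) := fun i => by
    rw [(hq i).2]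
    refine tendsto_nhdsWithin_of_tendsto_nhds (Continuous.tendsto' (by fun_prop) _ _ ?_)
    simp [hs]
  have hlim : Tendsto (fun h : ℝ => (n : ℝ)⁻¹ * ∑ i, δ i * invφ' (s i + h * δ i)) (𝓝[>] 0)
      (𝓝 ((n : ℝ)⁻¹ * ∑ i, δ i * q i)) :=
    (tendsto_finsetSum _ fun i _ =>
      ((hφ.tendsto_inverse hinv (hq i).1).1.comp (hpath i)).const_mul (δ i)).const_mul _
  refine ge_of_tendsto hlim ?_
  have hev := eventually_all.2 fun i =>
    (hpath i).eventually (hφ.tendsto_inverse hinv (hq i).1).2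
  filter_upwards [hev, self_mem_nhdsWithin] with h hh hpos
  have hpos : 0 < h := hpos
  have key := hmax (t + h • v)
  rw [hφ.dualValN_eq x g θ hq, hφ.dualValN_eq x g θ (t := t + h • v)
    (q := fun i => invφ' (s i + h * δ i))
    (fun i => by rw [tbar_add_smul]; exact hh i), EReal.coe_le_coe_iff] at key
  simp only [tbar_add_smul, Pi.add_apply, Pi.smul_apply, smul_eq_mul] at key
  have hle : ∑ i, ((s i + h * δ i) * invφ' (s i + h * δ i) - (φ (invφ' (s i + h * δ i))).toReal)
      ≤ ∑ i, (s i * q i - (φ (q i)).toReal) + h * ∑ i, δ i * invφ' (s i + h * δ i) := by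
    rw [Finset.mul_sum, ← Finset.sum_add_distrib]
    refine Finset.sum_le_sum fun i _ => ?_
    have := hφ.tangent_le (hq i).1 (hφ.dom_finite _ (hh i).1.1 (hh i).1.2)
    rw [(hq i).2] at this
    change _ + s i * _ ≤ _ at this
    linarith
  have hle' := mul_le_mul_of_nonneg_left hle (inv_nonneg.2 (Nat.cast_nonneg (α := ℝ) n))
  have : h * v 0 ≤ h * ((n : ℝ)⁻¹ * ∑ i, δ i * invφ' (s i + h * δ i)) := by
    simp only [hs, hδ] at hle' ⊢
    linarith
  exact le_of_mul_le_mul_left this hpos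

/-- A signed measure carried by a finite family of distinct points is determined by its values
at these points. -/
lemma signedMeasure_ext_of_absolutelyContinuous_PnEmp {mdim n : ℕ} {x : Fin n → Fin mdim → ℝ}
    (hx : Function.Injective x) {Q Q' : SignedMeasure (Fin mdim → ℝ)}
    (hQ : Q ≪ᵥ (PnEmp n x).toENNRealVectorMeasure)
    (hQ' : Q' ≪ᵥ (PnEmp n x).toENNRealVectorMeasure) (h : ∀ i, Q {x i} = Q' {x i}) : Q = Q' := by
  classical
  have key : ∀ R : SignedMeasure (Fin mdim → ℝ), R ≪ᵥ (PnEmp n x).toENNRealVectorMeasure →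
      ∀ A, MeasurableSet A →
        R A = ∑ i ∈ Finset.univ.filter (fun i => x i ∈ A), R {x i} := by
    intro R hR A hA
    have hF : MeasurableSet (⋃ i ∈ Finset.univ.filter (fun i => x i ∈ A), {x i}) :=
      Finset.measurableSet_biUnion _ fun i _ => measurableSet_singleton _
    have hsub : (⋃ i ∈ Finset.univ.filter (fun i => x i ∈ A), {x i}) ⊆ A := by
      exact iUnion₂_subset fun i hi => singleton_subset_iff.2 (Finset.mem_filter.1 hi).2
    have hnull : R (A \ ⋃ i ∈ Finset.univ.filter (fun i => x i ∈ A), {x i}) = 0 := by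
      apply hR
      rw [Measure.toENNRealVectorMeasure_apply_measurable (hA.diff hF), PnEmp, Measure.smul_apply,
        Measure.finsetSum_apply]
      simp only [Measure.dirac_apply' _ (hA.diff hF)]
      suffices ∀ i, x i ∈ A → ∃ j, x j ∈ A ∧ x i = x j by simpa
      exact fun i hi => ⟨i, hi, rfl⟩
    rw [← VectorMeasure.of_biUnion_finset (v := R) _ fun i _ => measurableSet_singleton (x i)]
    · conv_lhs => rw [← union_sdiff_cancel hsub]
      rw [VectorMeasure.of_union disjoint_sdiff_right hF (hA.diff hF), hnull, add_zero]
    · intro i _ j _ hij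
      exact disjoint_singleton.2 (hx.ne hij)
  refine VectorMeasure.ext fun A hA => ?_
  rw [key Q hQ A hA, key Q' hQ' A hA]
  exact Finset.sum_congr rfl fun i _ => h i

/-- There is a signed measure carried by the points `xᵢ` with prescribed point masses. -/
lemma exists_signedMeasure_absolutelyContinuous_PnEmp {mdim n : ℕ} {x : Fin n → Fin mdim → ℝ}
    (hx : Function.Injective x) (w : Fin n → ℝ) :
    ∃ Q : SignedMeasure (Fin mdim → ℝ), Q ≪ᵥ (PnEmp n x).toENNRealVectorMeasure ∧
      ∀ i, Q {x i} = w i := by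
  have happ : ∀ A, MeasurableSet A →
      (∑ i, w i • (Measure.dirac (x i)).toSignedMeasure : SignedMeasure (Fin mdim → ℝ)) A =
        ∑ i, w i * A.indicator 1 (x i) := by
    intro A hA
    rw [FunLike.coe_sum, Finset.sum_apply]
    refine Finset.sum_congr rfl fun i _ => ?_
    rw [_root_.smul_apply, Measure.toSignedMeasure_apply_measurable hA, smul_eq_mul,
      Measure.real, Measure.dirac_apply' _ hA]
    by_cases h : x i ∈ A <;> simp [h]
  refine ⟨∑ i, w i • (Measure.dirac (x i)).toSignedMeasure, fun A hA => ?_, fun i => ?_⟩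
  · by_cases hm : MeasurableSet A
    · rw [happ A hm]
      rw [Measure.toENNRealVectorMeasure_apply_measurable hm, PnEmp, Measure.smul_apply,
        Measure.finsetSum_apply] at hA
      simp only [smul_eq_mul, mul_eq_zero, ENNReal.inv_eq_zero, ENNReal.natCast_ne_top, false_or,
        Finset.sum_eq_zero_iff, Finset.mem_univ, true_imp_iff, Measure.dirac_apply' _ hm,
        indicator_apply_eq_zero, Pi.one_apply, one_ne_zero, imp_false] at hA
      exact Finset.sum_eq_zero fun i _ => by simp [hA i]
    · exact VectorMeasure.not_measurable _ hm
  · rw [happ _ (measurableSet_singleton _), Finset.sum_eq_single i]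
    · simp
    · intro j _ hj
      simp [hx.ne hj]
    · simp

/-- The primal criterion at a measure with finite values of `φ`. -/
lemma primalObjN_eq_ofReal {φ : ℝ → ℝ≥0∞} {mdim n : ℕ} (hn : n ≠ 0) {x : Fin n → Fin mdim → ℝ}
    {Q : SignedMeasure (Fin mdim → ℝ)} (h : ∀ i, φ (n * Q {x i}) ≠ ⊤) :
    primalObjN φ n x Q = ENNReal.ofReal ((n : ℝ)⁻¹ * ∑ i, (φ (n * Q {x i})).toReal) := by
  rw [primalObjN, ENNReal.ofReal_mul (by positivity),
    ENNReal.ofReal_inv_of_pos (by positivity), ENNReal.ofReal_natCast,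
    ENNReal.ofReal_sum_of_nonneg fun i _ => ENNReal.toReal_nonneg]
  simp only [ENNReal.ofReal_toReal (h _)]

lemma ne_top_of_primalObjN_ne_top {φ : ℝ → ℝ≥0∞} {mdim n : ℕ} {x : Fin n → Fin mdim → ℝ}
    {Q : SignedMeasure (Fin mdim → ℝ)} (h : primalObjN φ n x Q ≠ ⊤) (i : Fin n) :
    φ (n * Q {x i}) ≠ ⊤ := by
  intro hi
  refine h (ENNReal.mul_eq_top.2 (Or.inl ⟨by simp, ENNReal.sum_eq_top.2 ⟨i, by simp, hi⟩⟩))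

/-- Every element of `𝓜_θ⁽ⁿ⁾` integrates `tᵀḡ` to `t₀`. -/
lemma sum_tbar_mul_of_mem_MThetaN {mdim d l n : ℕ} {x : Fin n → Fin mdim → ℝ}
    {g : (Fin mdim → ℝ) → (Fin d → ℝ) → Fin l → ℝ} {θ : Fin d → ℝ}
    {Q : SignedMeasure (Fin mdim → ℝ)} (hQ : Q ∈ MThetaN n x g θ) (t : Fin (l + 1) → ℝ) :
    ∑ i, tbar t (g (x i) θ) * (n * Q {x i}) = n * t 0 := by
  have h1 : ∀ i, tbar t (g (x i) θ) * (n * Q {x i}) =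
      n * t 0 * Q {x i} + ∑ j, n * t (Fin.succ j) * (Q {x i} * g (x i) θ j) := fun i => by
    rw [tbar, add_mul, Finset.sum_mul]
    congr 1
    · ring
    · exact Finset.sum_congr rfl fun j _ => by ring
  simp only [h1, Finset.sum_add_distrib]
  rw [← Finset.mul_sum, hQ.2.1, Finset.sum_comm]
  simp [← Finset.mul_sum, hQ.2.2]

/-- **Proposition 1, converse part.** Fix `θ ∈ Θ` and points
`x₁,…,x_n ∈ ℝ^m`.  Suppose `t̂` maximizes the dual criterion
`t ↦ t₀ − (1/n) ∑ᵢ ψ(tᵀḡ(xᵢ,θ))` over `ℝ^{1+l}` with `a* < t̂ᵀḡ(xᵢ,θ) < b*` for all `i`.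
Then the dual equality holds, the primal infimum is attained at a unique
`Q⁽ⁿ⁾_θ ∈ 𝓜_θ⁽ⁿ⁾`, given by `Q⁽ⁿ⁾_θ({xᵢ}) = (1/n)·(φ')⁻¹(t̂ᵀḡ(xᵢ,θ))`, and `t̂`
solves the system `(1/n) ∑ᵢ (φ')⁻¹(t̂ᵀḡ(xᵢ,θ)) = 1`,
`(1/n) ∑ᵢ gⱼ(xᵢ,θ) (φ')⁻¹(t̂ᵀḡ(xᵢ,θ)) = 0` for `j = 1,…,l`. -/
theorem duality_empirical_converse {mdim d l n : ℕ} (hdl : d ≤ l)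
    (φ : ℝ → ℝ≥0∞) (a b : EReal) (φ' φ'' : ℝ → ℝ) (astar bstar : EReal)
    (hφ : PhiAssumptions φ a b φ' φ'' astar bstar)
    -- `(φ')⁻¹ : ]a*,b*[ → ]a,b[`, the inverse function of `φ'`
    (invφ' : ℝ → ℝ)
    (hinv : ∀ y : ℝ, a < (y : EReal) → (y : EReal) < b → invφ' (φ' y) = y)
    (hinv' : ∀ s : ℝ, astar < (s : EReal) → (s : EReal) < bstar →
      (a < ((invφ' s : ℝ) : EReal) ∧ ((invφ' s : ℝ) : EReal) < b) ∧ φ' (invφ' s) = s)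
    (Θset : Set (Fin d → ℝ)) (θ : Fin d → ℝ) (hθ : θ ∈ Θset)
    (g : (Fin mdim → ℝ) → (Fin d → ℝ) → Fin l → ℝ)
    (hgmeas : ∀ θ', Measurable fun x => g x θ')
    (x : Fin n → Fin mdim → ℝ) (hx : Function.Injective x)
    (that : Fin (l + 1) → ℝ)
    (hthat_max : ∀ t : Fin (l + 1) → ℝ, dualValN φ n x g θ t ≤ dualValN φ n x g θ that)
    (hthat_int : ∀ i : Fin n, astar < ((tbar that (g (x i) θ) : ℝ) : EReal) ∧
      ((tbar that (g (x i) θ) : ℝ) : EReal) < bstar) :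
    -- dual equality
    ((⨅ Q ∈ MThetaN n x g θ, primalObjN φ n x Q : ℝ≥0∞) : EReal)
        = (⨆ t : Fin (l + 1) → ℝ, dualValN φ n x g θ t) ∧
    -- the primal infimum is attained at a unique `Q ∈ 𝓜_θ⁽ⁿ⁾` …
    (∃! Q : SignedMeasure (Fin mdim → ℝ), Q ∈ MThetaN n x g θ ∧
      ∀ Q' ∈ MThetaN n x g θ, primalObjN φ n x Q ≤ primalObjN φ n x Q') ∧
    -- … which is given by `Q({xᵢ}) = (1/n)(φ')⁻¹(t̂ᵀḡ(xᵢ,θ))`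
    (∀ Q : SignedMeasure (Fin mdim → ℝ), Q ∈ MThetaN n x g θ →
      (∀ Q' ∈ MThetaN n x g θ, primalObjN φ n x Q ≤ primalObjN φ n x Q') →
      ∀ i : Fin n, Q {x i} = (n : ℝ)⁻¹ * invφ' (tbar that (g (x i) θ))) ∧
    -- and `t̂` solves the first-order system
    ((n : ℝ)⁻¹ * ∑ i : Fin n, invφ' (tbar that (g (x i) θ)) = 1 ∧
      ∀ j : Fin l,
        (n : ℝ)⁻¹ * ∑ i : Fin n, g (x i) θ j * invφ' (tbar that (g (x i) θ)) = 0) := by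
  set q : Fin n → ℝ := fun i => invφ' (tbar that (g (x i) θ)) with hqdef
  have hq : ∀ i, (a < (q i : EReal) ∧ (q i : EReal) < b) ∧
      φ' (q i) = tbar that (g (x i) θ) := fun i => hinv' _ (hthat_int i).1 (hthat_int i).2
  have hfo_le := hφ.first_order_le hinv hthat_max hq
  have hfo : ∀ v : Fin (l + 1) → ℝ, (n : ℝ)⁻¹ * ∑ i, tbar v (g (x i) θ) * q i = v 0 := by
    intro v
    refine le_antisymm ?_ (hfo_le v)
    have hneg : ∀ i, tbar (-v) (g (x i) θ) = -tbar v (g (x i) θ) := fun i => by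
      simp only [tbar, Pi.neg_apply, neg_mul, Finset.sum_neg_distrib, neg_add]
    have := hfo_le (-v)
    simp only [hneg, neg_mul, Finset.sum_neg_distrib, mul_neg, Pi.neg_apply] at this
    linarith
  have hsys0 : (n : ℝ)⁻¹ * ∑ i, q i = 1 := by
    simpa [tbar] using hfo (Pi.single 0 1)
  have hsys : ∀ j, (n : ℝ)⁻¹ * ∑ i, g (x i) θ j * q i = 0 := fun j => by
    simpa [tbar, Pi.single_apply] using hfo (Pi.single j.succ 1)
  have hn : n ≠ 0 := by
    rintro rfl
    simp at hsys0
  have hn' : (n : ℝ) ≠ 0 := Nat.cast_ne_zero.2 hn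
  obtain ⟨Q, hQac, hQ⟩ :=
    exists_signedMeasure_absolutelyContinuous_PnEmp hx fun i => (n : ℝ)⁻¹ * q i
  have hnQ : ∀ i, (n : ℝ) * Q {x i} = q i := fun i => by
    rw [hQ, mul_inv_cancel_left₀ hn']
  have hQmem : Q ∈ MThetaN n x g θ := by
    refine ⟨hQac, ?_, fun j => ?_⟩
    · simp only [hQ, ← Finset.mul_sum, hsys0]
    · rw [← hsys j, Finset.mul_sum]
      exact Finset.sum_congr rfl fun i _ => by rw [hQ]; ring
  have hqtop : ∀ i, φ (q i) ≠ ⊤ := fun i => hφ.dom_finite _ (hq i).1.1 (hq i).1.2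
  have hQval : primalObjN φ n x Q = ENNReal.ofReal ((n : ℝ)⁻¹ * ∑ i, (φ (q i)).toReal) := by
    rw [primalObjN_eq_ofReal hn fun i => by rw [hnQ]; exact hqtop i]
    simp only [hnQ]
  have htangent_sum : ∀ Q' ∈ MThetaN n x g θ, ∑ i, (φ (q i)).toReal =
      ∑ i, ((φ (q i)).toReal + φ' (q i) * (n * Q' {x i} - q i)) := by
    intro Q' hQ'
    have h1 := sum_tbar_mul_of_mem_MThetaN hQ' that
    have h2 := sum_tbar_mul_of_mem_MThetaN hQmem that
    simp only [hnQ] at h2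
    simp only [(hq _).2, mul_sub, Finset.sum_add_distrib, Finset.sum_sub_distrib, h1, h2]
    ring
  have hQmin : ∀ Q' ∈ MThetaN n x g θ, primalObjN φ n x Q ≤ primalObjN φ n x Q' := by
    intro Q' hQ'
    by_cases htop : primalObjN φ n x Q' = ⊤
    · rw [htop]
      exact le_top
    have hfin := ne_top_of_primalObjN_ne_top htop
    rw [hQval, primalObjN_eq_ofReal hn hfin, htangent_sum Q' hQ']
    refine ENNReal.ofReal_le_ofReal (mul_le_mul_of_nonneg_left ?_ (by positivity))
    exact Finset.sum_le_sum fun i _ => hφ.tangent_le (hq i).1 (hfin i)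
  have hunique : ∀ Q' ∈ MThetaN n x g θ,
      (∀ R ∈ MThetaN n x g θ, primalObjN φ n x Q' ≤ primalObjN φ n x R) →
      ∀ i, Q' {x i} = (n : ℝ)⁻¹ * q i := by
    intro Q' hQ' hopt
    have hle := hopt Q hQmem
    have hfin := ne_top_of_primalObjN_ne_top
      (ne_top_of_le_ne_top (by rw [hQval]; exact ENNReal.ofReal_ne_top) hle)
    rw [hQval, primalObjN_eq_ofReal hn hfin, ENNReal.ofReal_le_ofReal_iff (by positivity),
      mul_le_mul_iff_right₀ (by positivity), htangent_sum Q' hQ'] at hle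
    have htan : ∀ i ∈ Finset.univ, (φ (q i)).toReal + φ' (q i) * (n * Q' {x i} - q i) ≤
        (φ (n * Q' {x i})).toReal := fun i _ => hφ.tangent_le (hq i).1 (hfin i)
    have heq := (Finset.sum_eq_sum_iff_of_le htan).1 (le_antisymm (Finset.sum_le_sum htan) hle)
    intro i
    rw [← hφ.eq_of_le_tangent (hq i).1 (hfin i) (heq i (Finset.mem_univ i)).ge,
      inv_mul_cancel_left₀ hn']
  refine ⟨?_, ⟨Q, ⟨hQmem, hQmin⟩, fun Q' hQ' => ?_⟩, hunique, hsys0, hsys⟩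
  · have hinf : (⨅ Q ∈ MThetaN n x g θ, primalObjN φ n x Q) = primalObjN φ n x Q :=
      le_antisymm (iInf₂_le Q hQmem) (le_iInf₂ hQmin)
    have hsup : (⨆ t, dualValN φ n x g θ t) = dualValN φ n x g θ that :=
      le_antisymm (iSup_le hthat_max) (le_iSup _ that)
    rw [hinf, hsup, hQval, hφ.dualValN_eq x g θ hq, EReal.coe_ennreal_ofReal,
      max_eq_left (by positivity), EReal.coe_eq_coe_iff, Finset.sum_sub_distrib, mul_sub,
      hfo that]
    ring
  · exact signedMeasure_ext_of_absolutelyContinuous_PnEmp hx hQ'.1.1 hQac fun i => by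
      rw [hunique Q' hQ'.1 hQ'.2 i, hQ i]
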